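/- (Proposition A.6, lower bound in formula (A.14)) Let d be a crossover design in Λ_{t+1,n,p} with control replication r_{d0} = r0, so that r̃_{d0} = (p−1)·r0/p; write r̃0 = r̃_{d0} and q = ⌊r̃0/n⌋. If r̃0/(p−1) < n − r̃0 + n·q, then Σ_{u=1}^n n_{d0u}·ñ_{d0u} ≥ r̃0 + (2·r̃0 − n + r̃0/(p−1))·q − n·q²; otherwise Σ_{u=1}^n n_{d0u}·ñ_{d0u} ≥ 2·r̃0 + r̃0/(p−1) − n + (2·r̃0 − 2n + r̃0/(p−1))·q − n·q². -/

import Mathlib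

open Finset

/-- Number of periods (among the `p` periods, 0-indexed `0,…,p-1`) in which unit `u`
receives treatment `i` under design `d`. -/
def nC (d : ℕ → ℕ → ℕ) (p i u : ℕ) : ℕ :=
  ((Finset.range p).filter fun k => d k u = i).card

/-- Number of periods among the first `p-1` periods in which unit `u` receives
treatment `i` under design `d`. -/
def nT (d : ℕ → ℕ → ℕ) (p i u : ℕ) : ℕ :=
  ((Finset.range (p - 1)).filter fun k => d k u = i).card

/-- Number of units (among `n` units) receiving treatment `i` in period `k`. -/
def lC (d : ℕ → ℕ → ℕ) (n i k : ℕ) : ℕ :=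
  ((Finset.range n).filter fun u => d k u = i).card

/-- Number of appearances of treatment `i` immediately preceded by treatment `j`. -/
def mC (d : ℕ → ℕ → ℕ) (p n i j : ℕ) : ℕ :=
  ∑ u ∈ Finset.range n,
    ((Finset.range (p - 1)).filter fun k => d (k + 1) u = i ∧ d k u = j).card

/-- Total replication of treatment `i` in the design. -/
def rC (d : ℕ → ℕ → ℕ) (p n i : ℕ) : ℕ := ∑ u ∈ Finset.range n, nC d p i u

/-- Total replication of treatment `i` in the first `p-1` periods. -/
def rT (d : ℕ → ℕ → ℕ) (p n i : ℕ) : ℕ := ∑ u ∈ Finset.range n, nT d p i u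

theorem nT_le_nC (d : ℕ → ℕ → ℕ) (p i u : ℕ) : nT d p i u ≤ nC d p i u :=
  card_le_card (filter_subset_filter _ (range_subset_range.2 (Nat.sub_le p 1)))

theorem nC_le_nT_add_one (d : ℕ → ℕ → ℕ) (p i u : ℕ) : nC d p i u ≤ nT d p i u + 1 := by
  unfold nC nT
  rcases p with _ | p
  · simp
  · rw [range_add_one, filter_insert, Nat.add_sub_cancel]
    split_ifs
    · exact card_insert_le _ _
    · exact Nat.le_succ _

/-- The product lies above its tangent plane at `(a, b)` at every lattice point `(x, y)` with
`x ≤ y ≤ x + 1`, provided `a ≤ b ≤ a + 1`. -/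
theorem add_sub_mul_le_mul_of_le_add_one {x y a b : ℕ} (hxy : x ≤ y) (hyx : y ≤ x + 1)
    (hab : a ≤ b) (hba : b ≤ a + 1) :
    (b : ℝ) * x + a * y - a * b ≤ (y : ℝ) * x := by
  suffices h : 0 ≤ ((x : ℝ) - a) * ((y : ℝ) - b) by linarith
  rcases lt_trichotomy x a with h | rfl | h
  · have h₁ : (x : ℝ) ≤ a := by exact_mod_cast h.le
    have h₂ : (y : ℝ) ≤ b := by exact_mod_cast (by omega : y ≤ b)
    exact mul_nonneg_of_nonpos_of_nonpos (by linarith) (by linarith)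
  · simp
  · have h₁ : (a : ℝ) ≤ x := by exact_mod_cast h.le
    have h₂ : (b : ℝ) ≤ y := by exact_mod_cast (by omega : b ≤ y)
    exact mul_nonneg (by linarith) (by linarith)

theorem mul_rT_add_mul_rC_sub_le_sum (d : ℕ → ℕ → ℕ) (p n i : ℕ) {a b : ℕ}
    (hab : a ≤ b) (hba : b ≤ a + 1) :
    (b : ℝ) * rT d p n i + a * rC d p n i - n * (a * b) ≤
      ∑ u ∈ range n, (nC d p i u : ℝ) * (nT d p i u : ℝ) := by
  calc (b : ℝ) * rT d p n i + a * rC d p n i - n * (a * b)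
      = ∑ u ∈ range n, ((b : ℝ) * nT d p i u + a * nC d p i u - a * b) := by
        simp [rT, rC, sum_sub_distrib, sum_add_distrib, mul_sum]
    _ ≤ _ := sum_le_sum fun u _ => add_sub_mul_le_mul_of_le_add_one
        (nT_le_nC d p i u) (nC_le_nT_add_one d p i u) hab hba

/-- Proposition A.6, lower bound in formula (A.14): for a design in `Λ_{t+1,n,p}` with
control replication `r₀` (so `r̃₀ = (p-1)r₀/p`), writing `R = r̃₀` and `q = ⌊R/n⌋`:
if `R/(p-1) < n - R + n·q` then
`∑_u n_{d0u}·ñ_{d0u} ≥ R + (2R - n + R/(p-1))·q - n·q²`, and otherwise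
`∑_u n_{d0u}·ñ_{d0u} ≥ 2R + R/(p-1) - n + (2R - 2n + R/(p-1))·q - n·q²`
(evaluated in `ℝ`). -/
theorem stmt12 (t n p : ℕ) (ht : 0 < t) (hn : 0 < n) (hp : 3 ≤ p) (hpt : p ≤ t + 1)
    (d : ℕ → ℕ → ℕ) (hd : ∀ k < p, ∀ u < n, d k u ≤ t)
    (hper : ∀ k < p, p * lC d n 0 k = rC d p n 0)
    (hself : ∀ i ≤ t, mC d p n i i = 0)
    (hrt : p * rT d p n 0 = (p - 1) * rC d p n 0)
    (R q : ℕ) (hR : R = rT d p n 0) (hq : q = R / n) :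
    ((R : ℝ) / ((p : ℝ) - 1) < (n : ℝ) - (R : ℝ) + (n : ℝ) * (q : ℝ) →
      (R : ℝ) + (2 * (R : ℝ) - (n : ℝ) + (R : ℝ) / ((p : ℝ) - 1)) * (q : ℝ) -
          (n : ℝ) * (q : ℝ) ^ 2 ≤
        ∑ u ∈ Finset.range n, (nC d p 0 u : ℝ) * (nT d p 0 u : ℝ)) ∧
      (¬ ((R : ℝ) / ((p : ℝ) - 1) < (n : ℝ) - (R : ℝ) + (n : ℝ) * (q : ℝ)) →
        2 * (R : ℝ) + (R : ℝ) / ((p : ℝ) - 1) - (n : ℝ) +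
            (2 * (R : ℝ) - 2 * (n : ℝ) + (R : ℝ) / ((p : ℝ) - 1)) * (q : ℝ) -
              (n : ℝ) * (q : ℝ) ^ 2 ≤
          ∑ u ∈ Finset.range n, (nC d p 0 u : ℝ) * (nT d p 0 u : ℝ)) := by
  have hp' : (0 : ℝ) < (p : ℝ) - 1 := by
    have : (3 : ℝ) ≤ p := by exact_mod_cast hp
    linarith
  have hrC : (rC d p n 0 : ℝ) = R + R / ((p : ℝ) - 1) := by
    have h : (p : ℝ) * R = ((p : ℝ) - 1) * rC d p n 0 := by
      rw [hR, ← Nat.cast_pred (by omega : 0 < p)]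
      exact_mod_cast hrt
    field_simp
    linarith
  have h₁ := mul_rT_add_mul_rC_sub_le_sum d p n 0 (Nat.le_succ q) le_rfl
  have h₂ := mul_rT_add_mul_rC_sub_le_sum d p n 0 (le_refl (q + 1)) (Nat.le_succ _)
  rw [← hR, hrC] at h₁ h₂
  push_cast at h₁ h₂
  exact ⟨fun _ => by linarith, fun _ => by linarith⟩
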